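/- Let G=(V,E) be a finite simple graph on n vertices, γ ≥ n, and f(x) = -∑_v x_v + (γ/2) xᵀ A_G x - (1/2) xᵀ A_{G'} x. Suppose z ∈ {0,1}^n satisfies z_v = z_w = 1 for some edge (v,w) ∈ E. Then z is not a local minimizer of f over [0,1]^n. -/

import Mathlib

open scoped Classical
open Finset Matrix

/-- The dataless quadratic network objective
`f(x) = -∑_v x_v + (γ/2) xᵀ A_G x - (1/2) xᵀ A_{Gᶜ} x`. -/
noncomputable def quantNetObj {n : ℕ} (G : SimpleGraph (Fin n)) (γ : ℝ) (x : Fin n → ℝ) : ℝ :=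
  -(∑ v, x v) + γ / 2 * (x ⬝ᵥ ((G.adjMatrix ℝ) *ᵥ x)) - 1 / 2 * (x ⬝ᵥ ((Gᶜ.adjMatrix ℝ) *ᵥ x))

/-- Moving along a coordinate with zero diagonal entry changes a symmetric quadratic form
affinely. -/
theorem Matrix.IsSymm.dotProduct_mulVec_sub_smul_single {ι : Type*} [Fintype ι] [DecidableEq ι]
    {A : Matrix ι ι ℝ} (hA : A.IsSymm) {v : ι} (hv : A v v = 0) (z : ι → ℝ) (t : ℝ) :
    (z - t • Pi.single v (1 : ℝ)) ⬝ᵥ (A *ᵥ (z - t • Pi.single v (1 : ℝ))) =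
      z ⬝ᵥ (A *ᵥ z) - 2 * t * (A *ᵥ z) v := by
  have hsymm : z ⬝ᵥ (A *ᵥ Pi.single v 1) = (A *ᵥ z) v := by
    rw [dotProduct_mulVec, ← mulVec_transpose, hA.eq, dotProduct_single_one]
  have hdiag : (A *ᵥ Pi.single v (1 : ℝ)) v = 0 := by simp [hv]
  rw [mulVec_sub, mulVec_smul, sub_dotProduct, dotProduct_sub, dotProduct_sub, smul_dotProduct,
    smul_dotProduct, dotProduct_smul, dotProduct_smul, hsymm, single_one_dotProduct,
    single_one_dotProduct, hdiag]
  simp only [smul_eq_mul]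
  ring

/-- The objective is affine in each coordinate. -/
theorem quantNetObj_sub_smul_single {n : ℕ} (G : SimpleGraph (Fin n)) (γ : ℝ) (z : Fin n → ℝ)
    (v : Fin n) (t : ℝ) :
    quantNetObj G γ (z - t • Pi.single v (1 : ℝ)) = quantNetObj G γ z -
      t * (-1 + γ * (G.adjMatrix ℝ *ᵥ z) v - (Gᶜ.adjMatrix ℝ *ᵥ z) v) := by
  have hsum : ∑ u, (z - t • (Pi.single v 1 : Fin n → ℝ)) u = ∑ u, z u - t := by
    simp [Finset.sum_sub_distrib, ← Finset.mul_sum]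
  unfold quantNetObj
  rw [hsum, (G.isSymm_adjMatrix).dotProduct_mulVec_sub_smul_single (by simp),
    (Gᶜ.isSymm_adjMatrix).dotProduct_mulVec_sub_smul_single (by simp)]
  ring

/-- At a vector with entries in `[0, 1]`, the partial derivative of the objective at `v` is positive
as soon as some neighbour of `v` has entry `1`. -/
theorem quantNetObj_partial_pos {n : ℕ} (G : SimpleGraph (Fin n)) {γ : ℝ} (hγ : (n : ℝ) ≤ γ)
    {z : Fin n → ℝ} (hz : z ∈ Set.Icc (0 : Fin n → ℝ) 1) {v w : Fin n} (hvw : G.Adj v w)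
    (hw : z w = 1) :
    0 < -1 + γ * (G.adjMatrix ℝ *ᵥ z) v - (Gᶜ.adjMatrix ℝ *ᵥ z) v := by
  have hN : 1 ≤ (G.adjMatrix ℝ *ᵥ z) v := by
    rw [SimpleGraph.adjMatrix_mulVec_apply, ← hw]
    exact Finset.single_le_sum (fun u _ => hz.1 u) (by simpa using hvw)
  have hN' : (Gᶜ.adjMatrix ℝ *ᵥ z) v ≤ Gᶜ.degree v := by
    rw [SimpleGraph.adjMatrix_mulVec_apply, ← SimpleGraph.card_neighborFinset_eq_degree]
    simpa only [nsmul_eq_mul, mul_one] using Finset.sum_le_card_nsmul _ z 1 fun u _ => hz.2 u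
  have hdeg : (Gᶜ.degree v : ℝ) + 2 ≤ n := by
    have hpos : 0 < G.degree v := (G.degree_pos_iff_exists_adj v).2 ⟨w, hvw⟩
    have hlt := G.degree_lt_card_verts v
    have hcompl := G.degree_compl v
    rw [Fintype.card_fin] at hlt hcompl
    have : Gᶜ.degree v + 2 ≤ n := by omega
    exact_mod_cast this
  have hγ0 : 0 ≤ γ := (Nat.cast_nonneg n).trans hγ
  nlinarith [mul_le_mul_of_nonneg_left hN hγ0]

/-- for γ ≥ n, a binary vector having both endpoints of some edge equal to 1
is not a local minimizer of f over [0,1]^n. -/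
theorem stmt5 {n : ℕ} (G : SimpleGraph (Fin n)) (γ : ℝ) (hγ : (n : ℝ) ≤ γ)
    (z : Fin n → ℝ) (hbin : ∀ v, z v = 0 ∨ z v = 1)
    (v w : Fin n) (hvw : G.Adj v w) (hv : z v = 1) (hw : z w = 1) :
    ¬ IsLocalMinOn (quantNetObj G γ) (Set.Icc (0 : Fin n → ℝ) 1) z := by
  intro hmin
  have hz : z ∈ Set.Icc (0 : Fin n → ℝ) 1 := by
    constructor <;> intro u <;> rcases hbin u with h | h <;> simp [h]
  have hpath : Filter.Tendsto (fun t : ℝ => z - t • Pi.single v (1 : ℝ)) (nhdsWithin 0 (Set.Ioi 0))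
      (nhdsWithin z (Set.Icc (0 : Fin n → ℝ) 1)) := by
    refine tendsto_nhdsWithin_iff.2 ⟨?_, ?_⟩
    · have hcont : Continuous fun t : ℝ => z - t • (Pi.single v 1 : Fin n → ℝ) := by fun_prop
      simpa using (hcont.tendsto 0).mono_left nhdsWithin_le_nhds
    · filter_upwards [Ioo_mem_nhdsGT (zero_lt_one (α := ℝ))] with t ht
      constructor <;> intro u <;> rcases eq_or_ne u v with rfl | hu
      · simp [hv, ht.2.le]
      · simpa [hu] using hz.1 u
      · simp [hv, ht.1.le]
      · simpa [hu] using hz.2 u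
  obtain ⟨t, hle, ht⟩ := ((hpath.eventually hmin).and self_mem_nhdsWithin).exists
  rw [quantNetObj_sub_smul_single] at hle
  have := mul_pos (Set.mem_Ioi.1 ht) (quantNetObj_partial_pos G hγ hz hvw hw)
  linarith
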